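/- Characterization of the Takabayasi factor: if M lies in the even subalgebra of Cl₁,₃, M is invertible, and M·ι(v)·reverse(M) = ι(v) for every v ∈ ℝ⁴, then there exist real numbers a, b with a² + b² = 1 such that M = a·1 + b·ω; i.e. the most general such M is M = e^{ωβ/2} = cos(β/2) + ω sin(β/2) for some β ∈ ℝ. -/

import Mathlib

noncomputable section

/-- The weights of the quadratic form Q₁,₃ (index 0 timelike with weight +1,
indices 1,2,3 spacelike with weight −1). -/
def w13 : Fin 4 → ℝ := fun μ => if μ = 0 then 1 else -1

/-- The quadratic form Q₁,₃(x) = (x⁰)² − (x¹)² − (x²)² − (x³)² on ℝ⁴. -/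
def Q13 : QuadraticForm ℝ (Fin 4 → ℝ) := QuadraticMap.weightedSumSquares ℝ w13

/-- γ_μ = ι(e_μ), the image of the μ-th standard basis vector in Cl₁,₃. -/
def γ (μ : Fin 4) : CliffordAlgebra Q13 := CliffordAlgebra.ι Q13 (Pi.single μ 1)

/-- The pseudoscalar ω = γ₀γ₁γ₂γ₃ of Cl₁,₃. -/
def ω : CliffordAlgebra Q13 := γ 0 * γ 1 * γ 2 * γ 3

open CliffordAlgebra

lemma γ_mul_self (i : Fin 4) : γ i * γ i = algebraMap ℝ _ (w13 i) := by
  rw [γ, ι_sq_scalar]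
  congr 1
  simp [Q13, QuadraticMap.weightedSumSquares_apply, Pi.single_apply]

lemma γ_mul_γ_of_lt {i j : Fin 4} (h : j < i) : γ i * γ j = -(γ j * γ i) := by
  apply ι_mul_ι_comm_of_isOrtho
  rw [QuadraticMap.isOrtho_def]
  simp only [Q13, QuadraticMap.weightedSumSquares_apply, Pi.add_apply, Pi.single_apply,
    ← Finset.sum_add_distrib]
  have hne := h.ne
  refine Finset.sum_congr rfl fun k _ => ?_
  by_cases hi : k = i <;> by_cases hj : k = j <;> simp_all

lemma γ_mul_γ_mul_of_lt {i j : Fin 4} (h : j < i) (x : CliffordAlgebra Q13) :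
    γ i * (γ j * x) = -(γ j * (γ i * x)) := by
  rw [← mul_assoc, γ_mul_γ_of_lt h, neg_mul, mul_assoc]

lemma γ_zero_mul_self : γ 0 * γ 0 = 1 := by simp [γ_mul_self, w13]

lemma γ_mul_self_of_ne_zero {i : Fin 4} (h : i ≠ 0) : γ i * γ i = -1 := by
  simp [γ_mul_self, w13, h]

lemma γ_zero_mul_self_mul (x : CliffordAlgebra Q13) : γ 0 * (γ 0 * x) = x := by
  rw [← mul_assoc, γ_zero_mul_self, one_mul]

lemma γ_mul_self_mul_of_ne_zero {i : Fin 4} (h : i ≠ 0) (x : CliffordAlgebra Q13) :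
    γ i * (γ i * x) = -x := by
  rw [← mul_assoc, γ_mul_self_of_ne_zero h, neg_one_mul]

lemma ι_eq_sum_γ (v : Fin 4 → ℝ) : ι Q13 v = ∑ i, v i • γ i := by
  conv_lhs => rw [pi_eq_sum_univ' v]
  simp only [map_sum, map_smul, γ]

/-- The products of an even number of distinct `γ`s, with increasing indices. -/
def evenBlades : Set (CliffordAlgebra Q13) :=
  {1, γ 0 * γ 1, γ 0 * γ 2, γ 0 * γ 3, γ 1 * γ 2, γ 1 * γ 3, γ 2 * γ 3,
    γ 0 * (γ 1 * (γ 2 * γ 3))}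

lemma γ_mul_γ_mul_mem_span_evenBlades (i j : Fin 4) {x : CliffordAlgebra Q13}
    (hx : x ∈ Submodule.span ℝ evenBlades) :
    γ i * (γ j * x) ∈ Submodule.span ℝ evenBlades := by
  have h : ∀ y ∈ evenBlades, y ∈ Submodule.span ℝ evenBlades :=
    fun y hy => Submodule.subset_span hy
  simp only [evenBlades, Set.mem_insert_iff, Set.mem_singleton_iff, forall_eq_or_imp,
    forall_eq] at h
  obtain ⟨h, h01, h02, h03, h12, h13, h23, h0123⟩ := h
  induction hx using Submodule.span_induction with
  | zero => simp
  | add x y _ _ hx hy => simpa only [mul_add] using add_mem hx hy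
  | smul r x _ hx => simpa only [mul_smul_comm] using Submodule.smul_mem _ r hx
  | mem x hx =>
    simp only [evenBlades, Set.mem_insert_iff, Set.mem_singleton_iff] at hx
    fin_cases i <;> fin_cases j <;> rcases hx with rfl | rfl | rfl | rfl | rfl | rfl | rfl | rfl <;>
      simp only [Fin.zero_eta, Fin.mk_one, Fin.reduceFinMk, mul_one, mul_neg, neg_neg,
        γ_mul_γ_of_lt, γ_mul_γ_mul_of_lt, Fin.reduceLT, γ_zero_mul_self,
        γ_zero_mul_self_mul, ne_eq, Fin.reduceEq, not_false_eq_true, one_ne_zero,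
        γ_mul_self_of_ne_zero, γ_mul_self_mul_of_ne_zero, neg_mem_iff] <;>
      assumption

lemma mem_span_evenBlades {x : CliffordAlgebra Q13} (hx : x ∈ even Q13) :
    x ∈ Submodule.span ℝ evenBlades := by
  induction x, hx using even_induction with
  | algebraMap r =>
    rw [Algebra.algebraMap_eq_smul_one]
    exact Submodule.smul_mem _ _ (Submodule.subset_span (by simp [evenBlades]))
  | add x y _ _ hx hy => exact add_mem hx hy
  | ι_mul_ι_mul v w x _ hx =>
    simp only [ι_eq_sum_γ, Finset.sum_mul, Finset.mul_sum, Finset.smul_sum,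
      smul_mul_assoc, mul_smul_comm, mul_assoc]
    exact sum_mem fun i _ => sum_mem fun j _ => Submodule.smul_mem _ _ <|
      Submodule.smul_mem _ _ (γ_mul_γ_mul_mem_span_evenBlades _ _ hx)

lemma pseudoscalar_mul_self : ω * ω = -1 := by
  simp only [ω, mul_assoc, γ_mul_γ_mul_of_lt, Fin.reduceLT, zero_lt_one, mul_neg, neg_neg,
    γ_zero_mul_self_mul, ne_eq, Fin.reduceEq, not_false_eq_true, one_ne_zero,
    γ_mul_self_of_ne_zero, γ_mul_self_mul_of_ne_zero]

lemma γ_zero_mul_pseudoscalar : γ 0 * ω = -(ω * γ 0) := by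
  simp only [ω, mul_assoc, γ_mul_γ_of_lt, γ_mul_γ_mul_of_lt, Fin.reduceLT, zero_lt_one,
    mul_neg, neg_neg]

lemma reverse_γ (i : Fin 4) : reverse (γ i) = γ i := reverse_ι _

lemma reverse_pseudoscalar : reverse ω = ω := by
  simp only [ω, reverse.map_mul, reverse_γ, mul_assoc, γ_mul_γ_of_lt, γ_mul_γ_mul_of_lt,
    Fin.reduceLT, zero_lt_one, mul_neg, neg_mul, neg_neg]

/-- An even element commuting with `γ 0 * γ 1` and `γ 1 * γ 2` is a combination of `1` and `ω`. -/
lemma exists_eq_add_smul_pseudoscalar {x : CliffordAlgebra Q13} (hx : x ∈ even Q13)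
    (h01 : Commute x (γ 0 * γ 1)) (h12 : Commute x (γ 1 * γ 2)) :
    ∃ a b : ℝ, x = algebraMap ℝ (CliffordAlgebra Q13) a + b • ω := by
  set p := γ 0 * γ 1 with hp
  set q := γ 1 * γ 2 with hq
  have pp : p * p = 1 := by
    simp only [hp, mul_assoc, γ_mul_γ_mul_of_lt, zero_lt_one, mul_neg,
      γ_zero_mul_self_mul, γ_mul_self_of_ne_zero (i := 1) (by decide), neg_neg]
  have qq : q * q = -1 := by
    simp only [hq, mul_assoc, γ_mul_γ_mul_of_lt, Fin.reduceLT, mul_neg,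
      γ_mul_self_mul_of_ne_zero (i := 1) (by decide),
      γ_mul_self_of_ne_zero (i := 2) (by decide), neg_neg]
  have key : ∀ y ∈ Submodule.span ℝ evenBlades,
      ∃ a b : ℝ, y + p * (y * p) - q * ((y + p * (y * p)) * q) =
        algebraMap ℝ (CliffordAlgebra Q13) a + b • ω := by
    intro y hy
    induction hy using Submodule.span_induction with
    | zero => exact ⟨0, 0, by simp⟩
    | add y z _ _ hy hz =>
      obtain ⟨a, b, h⟩ := hy
      obtain ⟨c, d, h'⟩ := hz
      refine ⟨a + c, b + d, ?_⟩
      rw [map_add, add_smul, add_add_add_comm, ← h, ← h']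
      noncomm_ring
    | smul r y _ hy =>
      obtain ⟨a, b, h⟩ := hy
      refine ⟨r * a, r * b, ?_⟩
      rw [map_mul, ← Algebra.smul_def, mul_smul, ← smul_add, ← h]
      simp only [smul_mul_assoc, mul_smul_comm, ← smul_add, ← smul_sub]
    | mem y hy =>
      simp only [evenBlades, Set.mem_insert_iff, Set.mem_singleton_iff] at hy
      rcases hy with rfl | rfl | rfl | rfl | rfl | rfl | rfl | rfl
      on_goal 1 => refine ⟨4, 0, ?_⟩
      on_goal 8 => refine ⟨0, 4, ?_⟩
      on_goal 1 =>
        rw [one_mul, pp, ← two_smul ℝ (1 : CliffordAlgebra Q13), smul_mul_assoc, one_mul,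
          mul_smul_comm, qq, Algebra.algebraMap_eq_smul_one]
        module
      all_goals first | refine ⟨0, 0, ?_⟩ | skip
      all_goals
        simp only [hp, hq, ω, mul_one, mul_neg, neg_mul, neg_neg, mul_assoc, add_mul,
          mul_add, γ_mul_γ_of_lt, γ_mul_γ_mul_of_lt, Fin.reduceLT,
          γ_zero_mul_self, γ_zero_mul_self_mul, ne_eq, Fin.reduceEq, not_false_eq_true, one_ne_zero,
          γ_mul_self_of_ne_zero, γ_mul_self_mul_of_ne_zero, map_zero]
        module
  obtain ⟨a, b, h⟩ := key x (mem_span_evenBlades hx)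
  have hpx : p * (x * p) = x := by rw [h01.eq, ← mul_assoc, pp, one_mul]
  have hqx : q * ((x + x) * q) = -(x + x) := by
    rw [(h12.add_left h12).eq, ← mul_assoc, qq, neg_one_mul]
  rw [hpx, hqx] at h
  refine ⟨a / 4, b / 4, ?_⟩
  have h4 : x = (4⁻¹ : ℝ) • (x + x - -(x + x)) := by module
  rw [h4, h, Algebra.algebraMap_eq_smul_one, Algebra.algebraMap_eq_smul_one]
  module

/-- Characterization of the Takabayasi factor: if M lies in the even subalgebra of
Cl₁,₃, M is invertible, and M·ι(v)·reverse(M) = ι(v) for every v ∈ ℝ⁴, then there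
exist a, b ∈ ℝ with a² + b² = 1 and M = a·1 + b·ω; i.e. the most general such M is
M = e^{ωβ/2} = cos(β/2) + ω sin(β/2) for some β. -/
theorem takabayasi_factor_characterization (M : CliffordAlgebra Q13)
    (hM : M ∈ CliffordAlgebra.even Q13) (hunit : IsUnit M)
    (hfix : ∀ v : Fin 4 → ℝ,
      M * CliffordAlgebra.ι Q13 v * CliffordAlgebra.reverse M = CliffordAlgebra.ι Q13 v) :
    ∃ a b : ℝ, a ^ 2 + b ^ 2 = 1 ∧
      M = algebraMap ℝ (CliffordAlgebra Q13) a + b • ω := by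
  obtain ⟨u, rfl⟩ := hunit
  have hγ (i : Fin 4) : γ i * reverse (u : CliffordAlgebra Q13) = ↑u⁻¹ * γ i := by
    rw [Units.eq_inv_mul_iff_mul_eq, ← mul_assoc]
    exact hfix _
  have hγ' (i : Fin 4) : reverse (u : CliffordAlgebra Q13) * γ i = γ i * ↑u⁻¹ := by
    have hw : w13 i ≠ 0 := by unfold w13; split_ifs <;> norm_num
    have h : γ i * (γ i * reverse (u : CliffordAlgebra Q13)) * γ i =
        γ i * (↑u⁻¹ * γ i) * γ i := by rw [hγ]
    rw [← mul_assoc, γ_mul_self, mul_assoc, mul_assoc, mul_assoc, γ_mul_self,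
      ← Algebra.commutes, Algebra.left_comm, ← Algebra.smul_def, ← Algebra.smul_def] at h
    exact smul_right_injective _ hw h
  have hcomm (i j : Fin 4) : Commute (reverse (u : CliffordAlgebra Q13)) (γ i * γ j) := by
    rw [commute_iff_eq, ← mul_assoc, hγ', mul_assoc, ← hγ, mul_assoc]
  obtain ⟨a, b, hab⟩ := exists_eq_add_smul_pseudoscalar
    ((reverse_mem_evenOdd_iff Q13).mpr hM) (hcomm 0 1) (hcomm 1 2)
  have hu : (u : CliffordAlgebra Q13) = algebraMap ℝ _ a + b • ω := by
    rw [← reverse_reverse (u : CliffordAlgebra Q13), hab, map_add, map_smul, reverse.commutes,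
      reverse_pseudoscalar]
  refine ⟨a, b, ?_, hu⟩
  have h0 : (u : CliffordAlgebra Q13) * (γ 0 * reverse (u : CliffordAlgebra Q13)) * γ 0 = 1 := by
    rw [hγ, Units.mul_inv_cancel_left, γ_zero_mul_self]
  have h1 : γ 0 * (algebraMap ℝ (CliffordAlgebra Q13) a + b • ω) =
      (algebraMap ℝ (CliffordAlgebra Q13) a - b • ω) * γ 0 := by
    rw [mul_add, ← Algebra.commutes, mul_smul_comm, γ_zero_mul_pseudoscalar, sub_mul,
      smul_mul_assoc, smul_neg, sub_eq_add_neg]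
  rw [hab, h1, mul_assoc, mul_assoc, γ_zero_mul_self, mul_one, hu] at h0
  let : Invertible (2 : ℝ) := invertibleOfNonzero two_ne_zero
  apply FaithfulSMul.algebraMap_injective ℝ (CliffordAlgebra Q13)
  rw [map_one, ← h0]
  simp only [Algebra.algebraMap_eq_smul_one, add_mul, mul_sub, smul_mul_assoc, mul_smul_comm,
    one_mul, mul_one, pseudoscalar_mul_self]
  module
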